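/- Work in the monoid algebra ℤ[B_n], where B_n is the monoid of binary relations on Fin n under composition of relations. For X ⊆ Fin n let Δ_X denote the diagonal relation {(x, x) : x ∈ X} and set ε_X := Σ_{Y ⊆ X} (-1)^(|X| - |Y|) [Δ_Y]. Let σ be a permutation of Fin n and X, Y ⊆ Fin n such that the image of X under σ is NOT equal to Y. Then ε_Y * [graph σ] * ε_X = 0. -/

import Mathlib

/-- Binary relations on `Fin n`, as finite sets of pairs `(z, x)`. -/
abbrev BRel (n : ℕ) := Finset (Fin n × Fin n)

/-- Composition of binary relations: `(z, x) ∈ relComp β α ↔ ∃ y, (z, y) ∈ β ∧ (y, x) ∈ α`. -/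
def relComp {n : ℕ} (β α : BRel n) : BRel n :=
  Finset.univ.filter fun p => ∃ y : Fin n, (p.1, y) ∈ β ∧ (y, p.2) ∈ α

/-- The identity relation on `Fin n`. -/
def relId (n : ℕ) : BRel n :=
  Finset.univ.filter fun p => p.1 = p.2

theorem relComp_assoc {n : ℕ} (a b c : BRel n) :
    relComp (relComp a b) c = relComp a (relComp b c) := by
  ext ⟨z, x⟩
  simp only [relComp, Finset.mem_filter, Finset.mem_univ, true_and]
  constructor
  · rintro ⟨y, ⟨w, hw, hwy⟩, hc⟩
    exact ⟨w, hw, y, hwy, hc⟩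
  · rintro ⟨w, hw, y, hwy, hc⟩
    exact ⟨y, ⟨w, hw, hwy⟩, hc⟩

theorem relId_comp {n : ℕ} (a : BRel n) : relComp (relId n) a = a := by
  ext ⟨z, x⟩
  simp only [relComp, relId, Finset.mem_filter, Finset.mem_univ, true_and]
  constructor
  · rintro ⟨y, hy, hmem⟩
    simpa [hy] using hmem
  · intro h
    exact ⟨z, rfl, h⟩

theorem comp_relId {n : ℕ} (a : BRel n) : relComp a (relId n) = a := by
  ext ⟨z, x⟩
  simp only [relComp, relId, Finset.mem_filter, Finset.mem_univ, true_and]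
  constructor
  · rintro ⟨y, hmem, hy⟩
    simpa [hy] using hmem
  · intro h
    exact ⟨x, h, rfl⟩

/-- The monoid `B_n` of binary relations on `Fin n` under composition of relations,
with identity the identity relation. -/
instance brelMonoid (n : ℕ) : Monoid (BRel n) where
  mul := relComp
  one := relId n
  mul_assoc := relComp_assoc
  one_mul := relId_comp
  mul_one := comp_relId

/-- The graph of a permutation `σ`: the relation consisting of all pairs `(σ x, x)`. -/
def permGraph {n : ℕ} (σ : Equiv.Perm (Fin n)) : BRel n :=
  Finset.univ.image fun x => (σ x, x)

/-- The diagonal relation `Δ_X = {(x, x) : x ∈ X}`. -/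
def diagRel {n : ℕ} (X : Finset (Fin n)) : BRel n :=
  X.image fun x => (x, x)

/-- The idempotent `ε_X = ∑_{Y ⊆ X} (-1)^(|X| - |Y|) [Δ_Y]` in `ℤ[B_n]`. -/
noncomputable def eps {n : ℕ} (X : Finset (Fin n)) : MonoidAlgebra ℤ (BRel n) :=
  ∑ Y ∈ X.powerset, MonoidAlgebra.single (diagRel Y) ((-1 : ℤ) ^ (X.card - Y.card))

theorem mem_mul_brel {n : ℕ} (b a : BRel n) (z x : Fin n) :
    (z, x) ∈ b * a ↔ ∃ y, (z, y) ∈ b ∧ (y, x) ∈ a := by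
  change (z, x) ∈ relComp b a ↔ _
  simp [relComp]

theorem mem_diagRel {n : ℕ} (X : Finset (Fin n)) (z x : Fin n) :
    (z, x) ∈ diagRel X ↔ x ∈ X ∧ z = x := by
  simp only [diagRel, Finset.mem_image, Prod.mk.injEq]
  constructor
  · rintro ⟨a, ha, rfl, rfl⟩
    exact ⟨ha, rfl⟩
  · rintro ⟨hx, rfl⟩
    exact ⟨z, hx, rfl, rfl⟩

theorem mem_permGraph {n : ℕ} (σ : Equiv.Perm (Fin n)) (z x : Fin n) :
    (z, x) ∈ permGraph σ ↔ z = σ x := by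
  simp [permGraph, eq_comm]

theorem diagRel_mul_diagRel {n : ℕ} (X Y : Finset (Fin n)) :
    diagRel X * diagRel Y = diagRel (X ∩ Y) := by
  ext ⟨z, x⟩
  simp only [mem_mul_brel, mem_diagRel, Finset.mem_inter]
  constructor
  · rintro ⟨y, ⟨hy, rfl⟩, hx, rfl⟩
    exact ⟨⟨hy, hx⟩, rfl⟩
  · rintro ⟨⟨hX, hY⟩, rfl⟩
    exact ⟨z, ⟨hX, rfl⟩, hY, rfl⟩

theorem permGraph_mul_diagRel {n : ℕ} (σ : Equiv.Perm (Fin n)) (X : Finset (Fin n)) :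
    permGraph σ * diagRel X = diagRel (X.image fun x => σ x) * permGraph σ := by
  ext ⟨z, x⟩
  simp [mem_mul_brel, mem_diagRel, mem_permGraph, and_comm]

theorem single_diagRel_mul_eps {n : ℕ} (Z X : Finset (Fin n)) :
    MonoidAlgebra.single (diagRel Z) 1 * eps X =
      ∑ Y ∈ X.powerset, MonoidAlgebra.single (diagRel (Z ∩ Y)) ((-1 : ℤ) ^ (X.card - Y.card)) := by
  simp only [eps, Finset.mul_sum, MonoidAlgebra.single_mul_single, diagRel_mul_diagRel, one_mul]

theorem eps_mul_single_diagRel {n : ℕ} (X Z : Finset (Fin n)) :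
    eps X * MonoidAlgebra.single (diagRel Z) 1 = MonoidAlgebra.single (diagRel Z) 1 * eps X := by
  simp only [eps, Finset.mul_sum, Finset.sum_mul, MonoidAlgebra.single_mul_single,
    diagRel_mul_diagRel, one_mul, mul_one, Finset.inter_comm]

theorem single_diagRel_self_mul_eps {n : ℕ} (X : Finset (Fin n)) :
    MonoidAlgebra.single (diagRel X) 1 * eps X = eps X := by
  rw [single_diagRel_mul_eps, eps]
  refine Finset.sum_congr rfl fun Y hY => ?_
  rw [Finset.inter_eq_right.mpr (Finset.mem_powerset.mp hY)]

theorem single_diagRel_mul_eps_of_not_subset {n : ℕ} {X Z : Finset (Fin n)} (h : ¬X ⊆ Z) :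
    MonoidAlgebra.single (diagRel Z) 1 * eps X = 0 := by
  obtain ⟨a, haX, haZ⟩ := Finset.not_subset.mp h
  obtain ⟨W, haW, rfl⟩ : ∃ W : Finset (Fin n), a ∉ W ∧ X = insert a W :=
    ⟨X.erase a, Finset.notMem_erase a X, (Finset.insert_erase haX).symm⟩
  rw [single_diagRel_mul_eps, Finset.sum_powerset_insert haW, ← Finset.sum_add_distrib]
  refine Finset.sum_eq_zero fun Y hY => ?_
  have hYW := Finset.mem_powerset.mp hY
  have hcard := Finset.card_le_card hYW
  rw [Finset.inter_insert_of_notMem haZ, Finset.card_insert_of_notMem haW,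
    Finset.card_insert_of_notMem fun ha => haW (hYW ha), Nat.add_sub_add_right,
    Nat.sub_add_comm hcard, ← MonoidAlgebra.single_add, pow_succ]
  simp

/-- If the image of `X` under `σ` is not equal to `Y`, then in `ℤ[B_n]` one has
`ε_Y * [graph σ] * ε_X = 0`. -/
theorem eps_graph_eps_of_image_ne {n : ℕ} (σ : Equiv.Perm (Fin n))
    (X Y : Finset (Fin n)) (h : X.image (fun x => σ x) ≠ Y) :
    eps Y * MonoidAlgebra.single (permGraph σ) 1 * eps X = 0 := by
  have conj (Z : Finset (Fin n)) :
      MonoidAlgebra.single (permGraph σ) (1 : ℤ) * MonoidAlgebra.single (diagRel Z) 1 =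
        MonoidAlgebra.single (diagRel (Z.image fun x => σ x)) 1 *
          MonoidAlgebra.single (permGraph σ) 1 := by
    simp only [MonoidAlgebra.single_mul_single, permGraph_mul_diagRel]
  by_cases hY : Y ⊆ X.image fun x => σ x
  · have hX : ¬X ⊆ Y.image fun y => σ.symm y := by
      refine fun hX => h (Finset.Subset.antisymm ?_ hY)
      simpa [Finset.image_image, Function.comp_def] using
        Finset.image_subset_image (f := fun x => σ x) hX
    have hσ : (Y.image fun y => σ.symm y).image (fun x => σ x) = Y := by
      simp [Finset.image_image, Function.comp_def]
    have key := conj (Y.image fun y => σ.symm y)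
    rw [hσ] at key
    rw [← single_diagRel_self_mul_eps Y, ← eps_mul_single_diagRel, mul_assoc (eps Y), ← key,
      mul_assoc, mul_assoc, single_diagRel_mul_eps_of_not_subset hX, mul_zero, mul_zero]
  · rw [← single_diagRel_self_mul_eps X, mul_assoc, ← mul_assoc (MonoidAlgebra.single _ _),
      conj, ← mul_assoc, ← mul_assoc, eps_mul_single_diagRel,
      single_diagRel_mul_eps_of_not_subset hY, zero_mul, zero_mul]
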